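/- arXiv:2101.09030 — 10 statements merged into one kernel-verified Lean document; each statement's English description precedes it below -/
import Mathlib

section
/- Let G be a finite group with center Z, let p be a prime dividing |G|, and let a, b ∈ G \ Z be such that the images aZ and bZ both have order p² in G/Z and every element of G can be written in the form a^i b^j z with i, j integers and z ∈ Z. If 1 ≤ i, j ≤ p² − 1 and at least one of i, j is not divisible by p, then a^i b^j ≠ b^j a^i. -/
open Subgroup in
/-- If `x` commutes with `a ^ n` and `n` is coprime to the order of `a` modulo the center, then `x`
commutes with `a`. -/
theorem Commute.of_pow_of_coprime_orderOf_mod_center {G : Type*} [Group G] {a x : G} {n : ℕ}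
    (h : Commute (a ^ n) x) (hn : n.Coprime (orderOf (a : G ⧸ center G))) : Commute a x := by
  obtain ⟨m, hm⟩ := exists_pow_eq_self_of_coprime hn
  have hz : ((a ^ n) ^ m)⁻¹ * a ∈ center G := QuotientGroup.eq.mp (by simpa using hm)
  have hzx : Commute (((a ^ n) ^ m)⁻¹ * a) x := (mem_center_iff.mp hz x).symm
  simpa using (h.pow_left m).mul_left hzx

open Subgroup in
/-- If `a` and `b` generate `G` modulo the center, in the sense that every element is of the form
`a ^ i * b ^ j * z` with `z` central, then an element commuting with both is central. -/
theorem Subgroup.mem_center_of_commute_of_commute {G : Type*} [Group G] {a b x : G}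
    (hgen : ∀ g : G, ∃ (i j : ℤ) (z : G), z ∈ center G ∧ g = a ^ i * b ^ j * z)
    (hax : Commute a x) (hbx : Commute b x) : x ∈ center G := by
  refine mem_center_iff.mpr fun g ↦ ?_
  obtain ⟨i, j, z, hz, rfl⟩ := hgen g
  have hzx : Commute z x := (mem_center_iff.mp hz x).symm
  exact ((hax.zpow_left i).mul_left (hbx.zpow_left j)).mul_left hzx

open Subgroup in
theorem Subgroup.pow_notMem_center_of_lt_orderOf {G : Type*} [Group G] {a : G} {n : ℕ}
    (hn : n ≠ 0) (h : n < orderOf (a : G ⧸ center G)) : a ^ n ∉ center G := fun hmem ↦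
  pow_ne_one_of_lt_orderOf hn h <| by
    rw [← QuotientGroup.mk_pow]
    exact (QuotientGroup.eq_one_iff _).mpr hmem


/-- Let `G` be a finite group with center `Z`, `p` a prime dividing `|G|`, and
`a, b ∈ G \ Z` such that `aZ` and `bZ` have order `p²` in `G/Z` and every element of `G`
can be written as `a^i b^j z` with `i, j` integers and `z ∈ Z`. If `1 ≤ i, j ≤ p² - 1`
and at least one of `i, j` is not divisible by `p`, then `a^i b^j ≠ b^j a^i`. -/
theorem pow_mul_pow_ne_of_not_dvd {G : Type*} [Group G] [Fintype G] (p : ℕ)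
    (hp : p.Prime) (hpG : p ∣ Fintype.card G) (a b : G)
    (ha : a ∉ Subgroup.center G) (hb : b ∉ Subgroup.center G)
    (haZ : orderOf (a : G ⧸ Subgroup.center G) = p ^ 2)
    (hbZ : orderOf (b : G ⧸ Subgroup.center G) = p ^ 2)
    (hgen : ∀ g : G, ∃ (i j : ℤ) (z : G), z ∈ Subgroup.center G ∧ g = a ^ i * b ^ j * z)
    (i j : ℕ) (hi1 : 1 ≤ i) (hi2 : i ≤ p ^ 2 - 1) (hj1 : 1 ≤ j) (hj2 : j ≤ p ^ 2 - 1)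
    (hij : ¬ p ∣ i ∨ ¬ p ∣ j) :
    a ^ i * b ^ j ≠ b ^ j * a ^ i := by
  have hp2 : 0 < p ^ 2 := pow_pos hp.pos 2
  intro h
  have hab : Commute (a ^ i) (b ^ j) := h
  rcases hij with hi | hj
  · have hcop : i.Coprime (orderOf (a : G ⧸ Subgroup.center G)) :=
      haZ ▸ ((hp.coprime_iff_not_dvd.mpr hi).symm.pow_right 2)
    exact Subgroup.pow_notMem_center_of_lt_orderOf (by omega) (by omega)
      (Subgroup.mem_center_of_commute_of_commute hgen
        (hab.of_pow_of_coprime_orderOf_mod_center hcop) (Commute.self_pow b j))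
  · have hcop : j.Coprime (orderOf (b : G ⧸ Subgroup.center G)) :=
      hbZ ▸ ((hp.coprime_iff_not_dvd.mpr hj).symm.pow_right 2)
    exact Subgroup.pow_notMem_center_of_lt_orderOf (by omega) (by omega)
      (Subgroup.mem_center_of_commute_of_commute hgen
        (Commute.self_pow a i) (hab.symm.of_pow_of_coprime_orderOf_mod_center hcop))
end

section
/- There is no group H such that H/Z(H) is isomorphic to the nonabelian group of order 16 presented by ⟨x, y | x⁴ = y⁴ = 1, y x y⁻¹ = x³⟩ (the nonabelian split extension Z₄ ⋊ Z₄). In other words, the nonabelian split extension Z₄ ⋊ Z₄ is not capable. -/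
/-- Relators of the nonabelian split extension `Z₄ ⋊ Z₄`, i.e. the group of order 16
presented by `⟨x, y | x⁴ = y⁴ = 1, y x y⁻¹ = x³⟩`. Here `x` is the generator `0` and
`y` is the generator `1`. -/
def Z4rtimesZ4Rels : Set (FreeGroup (Fin 2)) :=
  {FreeGroup.of 0 ^ 4, FreeGroup.of 1 ^ 4,
    FreeGroup.of 1 * FreeGroup.of 0 * (FreeGroup.of 1)⁻¹ * (FreeGroup.of 0 ^ 3)⁻¹}

/-- The nonabelian split extension `Z₄ ⋊ Z₄`, presented by
`⟨x, y | x⁴ = y⁴ = 1, y x y⁻¹ = x³⟩`. -/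
def Z4rtimesZ4 : Type := PresentedGroup Z4rtimesZ4Rels

instance : Group Z4rtimesZ4 := by unfold Z4rtimesZ4; infer_instance

/-- If `b` conjugates `a` to `a ^ 3` modulo the center, and `a ^ 4` is central, then `b ^ 2`
commutes with `a`. -/
lemma commute_sq_of_conj_eq_pow_three_mul {H : Type*} [Group H] {a b z : H}
    (ha : a ^ 4 ∈ Subgroup.center H) (hz : z ∈ Subgroup.center H)
    (hab : b * a * b⁻¹ = a ^ 3 * z) : Commute (b ^ 2) a := by
  rw [Subgroup.mem_center_iff] at ha hz
  obtain ⟨w, hw, hconj⟩ : ∃ w : H, (∀ g, g * w = w * g) ∧ b * a * b⁻¹ = a⁻¹ * w :=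
    ⟨a ^ 4 * z, fun g => by rw [← mul_assoc, ha, mul_assoc, hz, mul_assoc],
      by rw [hab]; group⟩
  have hsq : b ^ 2 * a * (b ^ 2)⁻¹ = a :=
    calc b ^ 2 * a * (b ^ 2)⁻¹ = b * (b * a * b⁻¹) * b⁻¹ := by rw [pow_two]; group
      _ = b * a⁻¹ * (w * b⁻¹) := by rw [hconj]; group
      _ = (b * a * b⁻¹)⁻¹ * w := by rw [← hw]; group
      _ = w⁻¹ * (a * w) := by rw [hconj]; group
      _ = a := by rw [hw]; group
  exact mul_inv_eq_iff_eq_mul.mp hsq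

namespace Z4rtimesZ4

/-- The generator of `Z4rtimesZ4` of index `i`. -/
def gen (i : Fin 2) : Z4rtimesZ4 := PresentedGroup.of (rels := Z4rtimesZ4Rels) i

lemma gen_zero_pow_four : gen 0 ^ 4 = 1 :=
  PresentedGroup.one_of_mem (rels := Z4rtimesZ4Rels) (x := FreeGroup.of 0 ^ 4) (by
    simp [Z4rtimesZ4Rels])

lemma gen_one_conj_gen_zero : gen 1 * gen 0 * (gen 1)⁻¹ = gen 0 ^ 3 :=
  mul_inv_eq_one.mp <| PresentedGroup.one_of_mem (rels := Z4rtimesZ4Rels)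
    (x := FreeGroup.of 1 * FreeGroup.of 0 * (FreeGroup.of 1)⁻¹ * (FreeGroup.of 0 ^ 3)⁻¹) (by
    simp [Z4rtimesZ4Rels])

lemma closure_range_gen : Subgroup.closure (Set.range gen) = ⊤ :=
  PresentedGroup.closure_range_of Z4rtimesZ4Rels

lemma gen_one_sq_ne_one : gen 1 ^ 2 ≠ 1 := by
  let f : Fin 2 → Multiplicative (ZMod 4) := ![1, Multiplicative.ofAdd 1]
  have hf : ∀ r ∈ Z4rtimesZ4Rels, FreeGroup.lift f r = 1 := by
    rintro r (rfl | rfl | rfl)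
    · simp [f]
    · simp only [map_pow, FreeGroup.lift_apply_of]
      decide
    · simp [f]
  let φ : Z4rtimesZ4 →* Multiplicative (ZMod 4) := PresentedGroup.toGroup hf
  have hφ : φ (gen 1) = f 1 := PresentedGroup.toGroup.of hf
  intro h
  have hsq : f 1 ^ 2 = 1 := by rw [← hφ, ← map_pow, h, map_one]
  exact absurd hsq (by decide)

end Z4rtimesZ4

/-- There is no group `H` such that `H/Z(H)` is isomorphic to the nonabelian split
extension `Z₄ ⋊ Z₄`; i.e., the nonabelian split extension `Z₄ ⋊ Z₄` is not capable. -/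
theorem not_capable_Z4_rtimes_Z4 :
    ∀ (H : Type*) [Group H],
      IsEmpty ((H ⧸ Subgroup.center H) ≃* Z4rtimesZ4) := by
  intro H _
  refine ⟨fun e => ?_⟩
  let φ : H →* Z4rtimesZ4 := e.toMonoidHom.comp (QuotientGroup.mk' (Subgroup.center H))
  have hφ : Function.Surjective φ := e.surjective.comp (QuotientGroup.mk'_surjective _)
  have hker (g : H) : φ g = 1 ↔ g ∈ Subgroup.center H := by
    simp [φ]
  obtain ⟨a, ha⟩ := hφ (Z4rtimesZ4.gen 0)
  obtain ⟨b, hb⟩ := hφ (Z4rtimesZ4.gen 1)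
  have hcomm : Commute (b ^ 2) a := by
    refine commute_sq_of_conj_eq_pow_three_mul (z := (a ^ 3)⁻¹ * (b * a * b⁻¹)) ?_ ?_ (by group)
    · rw [← hker, map_pow, ha, Z4rtimesZ4.gen_zero_pow_four]
    · rw [← hker]
      simp only [map_mul, map_inv, map_pow, ha, hb, Z4rtimesZ4.gen_one_conj_gen_zero,
        inv_mul_cancel]
  have hmap : (Subgroup.centralizer {b ^ 2}).map φ = ⊤ := by
    rw [eq_top_iff, ← Z4rtimesZ4.closure_range_gen, Subgroup.closure_le]
    rintro _ ⟨i, rfl⟩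
    fin_cases i
    · exact ⟨a, Subgroup.mem_centralizer_singleton_iff.mpr hcomm.eq.symm, ha⟩
    · exact ⟨b, Subgroup.mem_centralizer_singleton_iff.mpr (Commute.self_pow b 2).eq, hb⟩
  have hcenter : b ^ 2 ∈ Subgroup.center H := by
    refine Subgroup.mem_center_iff.mpr fun g => ?_
    obtain ⟨c, hc, hcg⟩ : φ g ∈ (Subgroup.centralizer {b ^ 2}).map φ := hmap ▸ Subgroup.mem_top _
    have hz : c⁻¹ * g ∈ Subgroup.center H := by
      rw [← hker, map_mul, map_inv, hcg, inv_mul_cancel]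
    have hg : g ∈ Subgroup.centralizer {b ^ 2} := by
      simpa using mul_mem hc (Subgroup.center_le_centralizer _ hz)
    exact Subgroup.mem_centralizer_singleton_iff.mp hg
  exact Z4rtimesZ4.gen_one_sq_ne_one (by rw [← hb, ← map_pow, hker]; exact hcenter)
end

section
/- Let p be a prime and let L₂ be the group of order p⁴ presented by ⟨x, y | x^{p²} = y^{p²} = 1, y x = x^{p+1} y⟩. Then for all integers i, j with 0 ≤ i, j ≤ p² − 1, not both zero, the order of the element x^i y^j in L₂ equals p if p divides both i and j, and equals p² otherwise. -/
/-- Relators of the group `L₂ = ⟨x, y | x^(p²) = y^(p²) = 1, y x = x^(p+1) y⟩`,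
where `x` is the generator `0` and `y` is the generator `1`. -/
def L2Rels (p : ℕ) : Set (FreeGroup (Fin 2)) :=
  {FreeGroup.of 0 ^ p ^ 2, FreeGroup.of 1 ^ p ^ 2,
    FreeGroup.of 1 * FreeGroup.of 0 * (FreeGroup.of 0 ^ (p + 1) * FreeGroup.of 1)⁻¹}

/-- The group `L₂` of order `p⁴` presented by
`⟨x, y | x^(p²) = y^(p²) = 1, y x = x^(p+1) y⟩`. -/
def L2 (p : ℕ) : Type := PresentedGroup (L2Rels p)

instance (p : ℕ) : Group (L2 p) := by unfold L2; infer_instance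

section Metacyclic

variable {G : Type*} [Group G] {x y : G} {p : ℕ}

theorem pow_mul_pow_of_semiconjBy {r : ℕ} (h : SemiconjBy y x (x ^ r)) (i j : ℕ) :
    y ^ j * x ^ i = x ^ (i * r ^ j) * y ^ j := by
  induction j generalizing i with
  | zero => simp
  | succ j ih =>
    have hi : y * x ^ i = x ^ (i * r) * y := by
      have := (h.pow_right i).eq
      rwa [← pow_mul, mul_comm r i] at this
    rw [pow_succ, mul_assoc, hi, ← mul_assoc, ih, mul_assoc, mul_assoc, pow_succ' r j]

theorem mul_pow_of_semiconjBy {r : ℕ} (h : SemiconjBy y x (x ^ r)) (i j n : ℕ) :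
    (x ^ i * y ^ j) ^ n = x ^ (i * ∑ k ∈ Finset.range n, r ^ (j * k)) * y ^ (j * n) := by
  induction n with
  | zero => simp
  | succ n ih =>
    rw [pow_succ, ih, mul_assoc, ← mul_assoc _ (x ^ i), pow_mul_pow_of_semiconjBy h,
      Finset.sum_range_succ, mul_add, pow_add x, mul_add_one, pow_add y]
    simp only [mul_assoc]

theorem mul_pow_prime_of_dvd (hx : x ^ p ^ 2 = 1) (hy : y ^ p ^ 2 = 1)
    (h : SemiconjBy y x (x ^ (p + 1))) {i j : ℕ} (hi : p ∣ i) (hj : p ∣ j) :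
    (x ^ i * y ^ j) ^ p = 1 := by
  have hcomm : Commute y (x ^ p) := by
    have := h.pow_right p
    rwa [← pow_mul, show (p + 1) * p = p ^ 2 + p by ring, pow_add, hx, one_mul] at this
  obtain ⟨a, rfl⟩ := hi
  obtain ⟨b, rfl⟩ := hj
  have hc : Commute (x ^ (p * a)) (y ^ (p * b)) := by
    rw [pow_mul x]
    exact ((hcomm.pow_right a).pow_left _).symm
  rw [hc.mul_pow, ← pow_mul, ← pow_mul, show p * a * p = p ^ 2 * a by ring,
    show p * b * p = p ^ 2 * b by ring, pow_mul, pow_mul, hx, hy, one_pow, one_pow, one_mul]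

theorem dvd_sum_add_one_pow (p j : ℕ) :
    p ∣ ∑ k ∈ Finset.range p, (p + 1) ^ (j * k) := by
  rw [← ZMod.natCast_eq_zero_iff]
  simp

theorem mul_pow_prime_sq (hx : x ^ p ^ 2 = 1) (hy : y ^ p ^ 2 = 1)
    (h : SemiconjBy y x (x ^ (p + 1))) (i j : ℕ) :
    (x ^ i * y ^ j) ^ p ^ 2 = 1 := by
  rw [sq, pow_mul, mul_pow_of_semiconjBy h]
  exact mul_pow_prime_of_dvd hx hy h ((dvd_sum_add_one_pow p j).mul_left i) (dvd_mul_left p j)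

end Metacyclic

theorem ZMod.add_one_pow_of_dvd {p n : ℕ} (h : p ∣ n) : ((p : ZMod (p ^ 2)) + 1) ^ n = 1 := by
  obtain ⟨m, rfl⟩ := h
  have key : ((p : ZMod (p ^ 2)) + 1) ^ p = 1 := by
    have hp2 : (p : ZMod (p ^ 2)) ^ 2 = 0 := by exact_mod_cast ZMod.natCast_self (p ^ 2)
    have hk : ∀ k : ℕ, ((p : ZMod (p ^ 2)) + 1) ^ k = 1 + k * p := fun k ↦ by
      induction k with
      | zero => simp
      | succ k ih =>
        rw [pow_succ _ k, ih]
        push_cast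
        linear_combination (k : ZMod (p ^ 2)) * hp2
    rw [hk]
    linear_combination hp2
  rw [pow_mul, key, one_pow]

namespace L2

variable (p : ℕ)

/-- The first generator of `L2 p`. -/
def x : L2 p := PresentedGroup.of 0

/-- The second generator of `L2 p`. -/
def y : L2 p := PresentedGroup.of 1

theorem x_pow : x p ^ p ^ 2 = 1 :=
  PresentedGroup.one_of_mem (rels := L2Rels p) (x := FreeGroup.of 0 ^ p ^ 2) (by simp [L2Rels])

theorem y_pow : y p ^ p ^ 2 = 1 :=
  PresentedGroup.one_of_mem (rels := L2Rels p) (x := FreeGroup.of 1 ^ p ^ 2) (by simp [L2Rels])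

theorem semiconjBy_y_x : SemiconjBy (y p) (x p) (x p ^ (p + 1)) :=
  mul_inv_eq_one.mp <| PresentedGroup.one_of_mem (rels := L2Rels p)
    (x := FreeGroup.of 1 * FreeGroup.of 0 * (FreeGroup.of 0 ^ (p + 1) * FreeGroup.of 1)⁻¹)
    (by simp [L2Rels])

variable {p}

/-- The universal property of the presentation of `L2 p`. -/
theorem exists_hom {G : Type*} [Group G] {a b : G} (ha : a ^ p ^ 2 = 1) (hb : b ^ p ^ 2 = 1)
    (hab : b * a = a ^ (p + 1) * b) :
    ∃ f : L2 p →* G, f (x p) = a ∧ f (y p) = b := by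
  have hrel : ∀ r ∈ L2Rels p, FreeGroup.lift ![a, b] r = 1 := by
    rintro r (rfl | rfl | rfl)
    · simpa using ha
    · simpa using hb
    · simpa [mul_inv_eq_one, ← mul_inv_rev] using hab
  exact ⟨PresentedGroup.toGroup hrel, PresentedGroup.toGroup.of hrel (x := 0),
    PresentedGroup.toGroup.of hrel (x := 1)⟩

/-- `L2 p` acts on `ZMod (p ^ 2)` by affine maps. -/
theorem exists_affine_hom (hp : p ≠ 0) : ∃ f : L2 p →* Equiv.Perm (ZMod (p ^ 2)),
    (∀ (i : ℕ) z, f (x p ^ i) z = i + z) ∧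
    ∀ (j : ℕ) z, f (y p ^ j) z = ((p : ZMod (p ^ 2)) + 1) ^ j * z := by
  have hunit : IsUnit ((p : ZMod (p ^ 2)) + 1) :=
    IsUnit.of_pow_eq_one (ZMod.add_one_pow_of_dvd dvd_rfl) hp
  obtain ⟨u, hu⟩ := hunit
  have hpow : ∀ (j : ℕ) z, ((MulAction.toPermHom (ZMod (p ^ 2))ˣ (ZMod (p ^ 2))) u ^ j) z
      = ((p : ZMod (p ^ 2)) + 1) ^ j * z := fun j z ↦ by
    rw [← map_pow, ← hu]
    simp [Units.smul_def]
  have hpow' : ∀ (i : ℕ) z, (Equiv.addLeft (1 : ZMod (p ^ 2)) ^ i) z = i + z := fun i z ↦ by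
    rw [Equiv.Perm.coe_pow, Equiv.coe_addLeft, add_left_iterate, nsmul_one]
  obtain ⟨f, hf0, hf1⟩ := exists_hom (p := p) (a := Equiv.addLeft (1 : ZMod (p ^ 2)))
    (b := MulAction.toPermHom (ZMod (p ^ 2))ˣ (ZMod (p ^ 2)) u)
    (by ext1 z; rw [hpow', ZMod.natCast_self]; simp)
    (by ext1 z; rw [hpow, ZMod.add_one_pow_of_dvd (dvd_pow_self p two_ne_zero)]; simp)
    (by
      ext1 z
      have h1 := hpow 1
      simp only [pow_one] at h1
      rw [Equiv.Perm.mul_apply, Equiv.Perm.mul_apply, hpow', h1, h1, Equiv.coe_addLeft]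
      push_cast
      ring)
  exact ⟨f, fun i z ↦ by rw [map_pow, hf0, hpow'], fun j z ↦ by rw [map_pow, hf1, hpow]⟩

theorem dvd_of_pow_mul_pow_eq_one (hp : p ≠ 0) {i j : ℕ}
    (h : x p ^ i * y p ^ j = 1) :
    p ^ 2 ∣ i ∧ p ^ 2 ∣ j := by
  constructor
  · obtain ⟨f, hf0, hf1⟩ := exists_affine_hom hp
    have := congrArg (fun g ↦ f g 0) h
    rw [← ZMod.natCast_eq_zero_iff]
    simpa only [map_mul, Equiv.Perm.mul_apply, hf0, hf1, mul_zero, add_zero, map_one,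
      Equiv.Perm.one_apply] using this
  · obtain ⟨f, hf0, hf1⟩ := exists_hom (p := p) (a := 1)
      (b := Multiplicative.ofAdd (1 : ZMod (p ^ 2))) (by simp)
      (by rw [← ofAdd_nsmul, nsmul_one, ZMod.natCast_self, ofAdd_zero]) (by simp)
    have := congrArg f h
    rw [map_mul, map_pow, map_pow, hf0, hf1, one_pow, one_mul, map_one f, ← ofAdd_nsmul, nsmul_one,
      ofAdd_eq_one] at this
    rwa [← ZMod.natCast_eq_zero_iff]

end L2

/-- Let `p` be a prime and `L₂ = ⟨x, y | x^(p²) = y^(p²) = 1, y x = x^(p+1) y⟩`. Then for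
all integers `0 ≤ i, j ≤ p² - 1`, not both zero, the order of `x^i y^j` in `L₂` equals `p`
if `p` divides both `i` and `j`, and equals `p²` otherwise. -/
theorem orderOf_L2_pow_mul_pow (p : ℕ) (hp : p.Prime) (i j : ℕ)
    (hi : i ≤ p ^ 2 - 1) (hj : j ≤ p ^ 2 - 1) (hij : ¬ (i = 0 ∧ j = 0)) :
    orderOf ((PresentedGroup.of 0 : L2 p) ^ i * (PresentedGroup.of 1 : L2 p) ^ j)
      = if p ∣ i ∧ p ∣ j then p else p ^ 2 := by
  change orderOf (L2.x p ^ i * L2.y p ^ j) = _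
  have := Fact.mk hp
  have hx := L2.x_pow p
  have hy := L2.y_pow p
  have hs := L2.semiconjBy_y_x p
  have hpos : 0 < p ^ 2 := pow_pos hp.pos 2
  split_ifs with h
  · refine orderOf_eq_prime (mul_pow_prime_of_dvd hx hy hs h.1 h.2) fun h1 ↦ hij ?_
    obtain ⟨hi', hj'⟩ := L2.dvd_of_pow_mul_pow_eq_one hp.ne_zero h1
    exact ⟨Nat.eq_zero_of_dvd_of_lt hi' (by omega), Nat.eq_zero_of_dvd_of_lt hj' (by omega)⟩
  · refine orderOf_eq_prime_pow (n := 1) (fun h1 ↦ h ?_) (mul_pow_prime_sq hx hy hs i j)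
    rw [pow_one] at h1
    have h2 := h1
    rw [mul_pow_of_semiconjBy hs] at h2
    have hj' : p ∣ j := by
      have := (L2.dvd_of_pow_mul_pow_eq_one hp.ne_zero h2).2
      rw [sq] at this
      exact Nat.dvd_of_mul_dvd_mul_right hp.pos this
    refine ⟨?_, hj'⟩
    have h3 := (L2.dvd_of_pow_mul_pow_eq_one hp.ne_zero h2).1
    rw [← ZMod.natCast_eq_zero_iff] at h3
    push_cast at h3
    simp only [ZMod.add_one_pow_of_dvd (hj'.mul_right _), Finset.sum_const, Finset.card_range,
      nsmul_one] at h3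
    norm_cast at h3
    rw [ZMod.natCast_eq_zero_iff, sq] at h3
    exact Nat.dvd_of_mul_dvd_mul_right hp.pos h3
end

section
/- Let G be a finite group with center Z, p a prime, r ∈ {0, 1}, and a, b ∈ G \ Z with a^{p²}, b^{p²} ∈ Z, such that for all nonnegative integers i, j, k there exists z ∈ Z with (a^i b^j)^k = a^{(k(k−1)/2)·ijrp} · a^{ki} · b^{kj} · z. Then for all i, j with 1 ≤ i, j ≤ p − 1 there exist an integer n not divisible by p, an integer s with 1 ≤ s ≤ p − 1, and z ∈ Z such that a^{ip} b^{jp} = (a^{sp} b^p)^n z. -/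
/-- Lemma 2.4(i): under the power-formula hypothesis, for `1 ≤ i, j ≤ p - 1` there are
`n` not divisible by `p`, `1 ≤ s ≤ p - 1` and `z ∈ Z` with
`a^(ip) b^(jp) = (a^(sp) b^p)^n z`. -/
theorem exists_rep_pow_p_pow_p {G : Type*} [Group G] [Fintype G] (p : ℕ) (hp : p.Prime) (r : ℕ)
    (hr : r = 0 ∨ r = 1) (a b : G)
    (ha : a ∉ Subgroup.center G) (hb : b ∉ Subgroup.center G)
    (hap : a ^ p ^ 2 ∈ Subgroup.center G) (hbp : b ^ p ^ 2 ∈ Subgroup.center G)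
    (hpow : ∀ i j k : ℕ, ∃ z ∈ Subgroup.center G,
      (a ^ i * b ^ j) ^ k
        = a ^ (k * (k - 1) / 2 * (i * j * r * p)) * a ^ (k * i) * b ^ (k * j) * z)
    (i j : ℕ) (hi1 : 1 ≤ i) (hi2 : i ≤ p - 1) (hj1 : 1 ≤ j) (hj2 : j ≤ p - 1) :
    ∃ (n s : ℕ) (z : G), ¬ p ∣ n ∧ 1 ≤ s ∧ s ≤ p - 1 ∧ z ∈ Subgroup.center G ∧
      a ^ (i * p) * b ^ (j * p) = (a ^ (s * p) * b ^ p) ^ n * z := by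
  have : Fact p.Prime := ⟨hp⟩
  have not_dvd {m : ℕ} (h1 : 1 ≤ m) (h2 : m ≤ p - 1) : ¬ p ∣ m :=
    fun h ↦ absurd (Nat.le_of_dvd h1 h) (by have := hp.two_le; omega)
  have hi0 : (i : ZMod p) ≠ 0 := by
    simpa [ZMod.natCast_eq_zero_iff] using not_dvd hi1 hi2
  have hj0 : (j : ZMod p) ≠ 0 := by
    simpa [ZMod.natCast_eq_zero_iff] using not_dvd hj1 hj2
  obtain ⟨s, hs⟩ : ∃ s, s = ((i : ZMod p) / j).val := ⟨_, rfl⟩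
  have hs0 : s ≠ 0 := by
    rw [hs, ZMod.val_ne_zero]
    exact div_ne_zero hi0 hj0
  have hslt : s < p := hs ▸ ZMod.val_lt _
  have hmod : j * s ≡ i [MOD p] := by
    rw [← ZMod.natCast_eq_natCast_iff, hs]
    push_cast
    rw [ZMod.natCast_zmod_val, mul_div_cancel₀ _ hj0]
  have hmod2 : j * (s * p) ≡ i * p [MOD p ^ 2] := by
    have := hmod.mul_right' p
    rwa [← sq, mul_assoc] at this
  let π := QuotientGroup.mk' (Subgroup.center G)
  have map_central {z : G} (hz : z ∈ Subgroup.center G) : π z = 1 :=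
    (QuotientGroup.eq_one_iff z).2 hz
  have hord : orderOf (π a) ∣ p ^ 2 := by
    rw [orderOf_dvd_iff_pow_eq_one, ← map_pow, map_central hap]
  obtain ⟨z, hz, h⟩ := hpow (s * p) p j
  have hπ : π ((a ^ (s * p) * b ^ p) ^ j) = π (a ^ (i * p) * b ^ (j * p)) := by
    rw [h]
    simp only [map_mul, map_pow, map_central hz, mul_one]
    have h1 : π a ^ (j * (j - 1) / 2 * (s * p * p * r * p)) = 1 :=
      orderOf_dvd_iff_pow_eq_one.1
        (hord.trans ⟨j * (j - 1) / 2 * (s * r * p), by ring⟩)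
    rw [h1, one_mul, pow_eq_pow_iff_modEq.2 (hmod2.of_dvd hord)]
  exact ⟨j, s, _, not_dvd hj1 hj2, by omega, by omega, QuotientGroup.eq.1 hπ,
    (mul_inv_cancel_left _ _).symm⟩
end

section
/- Let G be a finite group with center Z, p a prime, r ∈ {0, 1}, and a, b ∈ G \ Z with a^{p²}, b^{p²} ∈ Z, such that for all nonnegative integers i, j, k there exists z ∈ Z with (a^i b^j)^k = a^{(k(k−1)/2)·ijrp} · a^{ki} · b^{kj} · z. Then for all i, j with 1 ≤ i ≤ p − 1, 1 ≤ j ≤ p² − 1 and p ∤ j, there exist an integer n not divisible by p, an integer s with 1 ≤ s ≤ p − 1, and z ∈ Z such that a^{ip} b^j = (a^{sp} b)^n z. -/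
theorem exists_mul_eq_add_mul_of_prime_of_not_dvd {p i j : ℕ} (hp : p.Prime) (hpj : ¬ p ∣ j)
    (hi1 : 1 ≤ i) (hi2 : i < p) :
    ∃ s, 1 ≤ s ∧ s < p ∧ ∃ t, j * s = i + p * t := by
  have := Fact.mk hp
  have hj : (j : ZMod p) ≠ 0 := by rwa [Ne, ZMod.natCast_eq_zero_iff]
  set s := ((i : ZMod p) * (j : ZMod p)⁻¹).val
  have hmod : j * s % p = i := by
    have h : ((j * s : ℕ) : ZMod p) = (i : ℕ) := by
      rw [Nat.cast_mul, ZMod.natCast_zmod_val, mul_comm, inv_mul_cancel_right₀ hj]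
    rw [(ZMod.natCast_eq_natCast_iff' _ _ _).mp h, Nat.mod_eq_of_lt hi2]
  refine ⟨s, Nat.pos_of_ne_zero fun hs => ?_, ZMod.val_lt _, j * s / p, ?_⟩
  · simp [hs] at hmod
    omega
  · have := Nat.mod_add_div (j * s) p
    omega


/-- Lemma 2.4(ii): under the power-formula hypothesis, for `1 ≤ i ≤ p - 1`,
`1 ≤ j ≤ p² - 1` with `p ∤ j`, there are `n` not divisible by `p`, `1 ≤ s ≤ p - 1`
and `z ∈ Z` with `a^(ip) b^j = (a^(sp) b)^n z`. -/
theorem exists_rep_pow_p_b {G : Type*} [Group G] [Fintype G] (p : ℕ) (hp : p.Prime) (r : ℕ)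
    (hr : r = 0 ∨ r = 1) (a b : G)
    (ha : a ∉ Subgroup.center G) (hb : b ∉ Subgroup.center G)
    (hap : a ^ p ^ 2 ∈ Subgroup.center G) (hbp : b ^ p ^ 2 ∈ Subgroup.center G)
    (hpow : ∀ i j k : ℕ, ∃ z ∈ Subgroup.center G,
      (a ^ i * b ^ j) ^ k
        = a ^ (k * (k - 1) / 2 * (i * j * r * p)) * a ^ (k * i) * b ^ (k * j) * z)
    (i j : ℕ) (hi1 : 1 ≤ i) (hi2 : i ≤ p - 1) (hj1 : 1 ≤ j) (hj2 : j ≤ p ^ 2 - 1)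
    (hpj : ¬ p ∣ j) :
    ∃ (n s : ℕ) (z : G), ¬ p ∣ n ∧ 1 ≤ s ∧ s ≤ p - 1 ∧ z ∈ Subgroup.center G ∧
      a ^ (i * p) * b ^ j = (a ^ (s * p) * b) ^ n * z := by
  obtain ⟨s, hs1, hs2, t, ht⟩ :=
    exists_mul_eq_add_mul_of_prime_of_not_dvd hp hpj hi1 (by have := hp.pos; omega)
  obtain ⟨z, hz, h⟩ := hpow (s * p) 1 j
  have hc : ∀ m : ℕ, (a ^ p ^ 2) ^ m ∈ Subgroup.center G := fun m => pow_mem hap m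
  set m := j * (j - 1) / 2 * (s * r)
  have hm : a ^ (j * (j - 1) / 2 * (s * p * 1 * r * p)) * a ^ (j * (s * p))
      = (a ^ p ^ 2) ^ (m + t) * a ^ (i * p) := by
    have hexp : j * (s * p) = p ^ 2 * t + i * p := by linear_combination p * ht
    rw [hexp, ← pow_mul, ← pow_add, ← pow_add]
    congr 1
    simp only [m]
    ring
  rw [hm, mul_one] at h
  refine ⟨j, s, ((a ^ p ^ 2) ^ (m + t) * z)⁻¹, hpj, hs1, by omega,
    inv_mem (mul_mem (hc _) hz), ?_⟩
  rw [pow_one] at h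
  rw [h, eq_mul_inv_iff_mul_eq, ← mul_assoc, Subgroup.mem_center_iff.mp (hc (m + t))]
  simp only [mul_assoc]
end

section
/- Let G be a finite group with center Z, p a prime, r ∈ {0, 1}, and a, b ∈ G \ Z with a^{p²}, b^{p²} ∈ Z, such that for all nonnegative integers i, j, k there exists z ∈ Z with (a^i b^j)^k = a^{(k(k−1)/2)·ijrp} · a^{ki} · b^{kj} · z. Then for all i, j with 1 ≤ j ≤ p − 1, 1 ≤ i ≤ p² − 1 and p ∤ i, there exist an integer n not divisible by p, an integer s with 1 ≤ s ≤ p − 1, and z ∈ Z such that a^i b^{jp} = (a b^{sp})^n z. -/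
/-- A unit `i` modulo a prime `p` divides every nonzero residue `j`, with a nonzero quotient. -/
theorem exists_mul_mod_eq {p i j : ℕ} (hp : p.Prime) (hpi : ¬ p ∣ i) (hj1 : 1 ≤ j) (hjp : j < p) :
    ∃ s, 1 ≤ s ∧ s < p ∧ i * s % p = j := by
  obtain ⟨m, -, hm⟩ := Nat.exists_mul_mod_eq_one_of_coprime
    ((hp.coprime_iff_not_dvd.mpr hpi).symm) hp.one_lt
  have hmod : i * (m * j % p) % p = j := by
    rw [Nat.mul_mod_mod, ← mul_assoc, Nat.mul_mod, hm, one_mul, Nat.mod_mod, Nat.mod_eq_of_lt hjp]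
  refine ⟨m * j % p, Nat.one_le_iff_ne_zero.mpr fun h0 => ?_, Nat.mod_lt _ hp.pos, hmod⟩
  rw [h0, mul_zero, Nat.zero_mod] at hmod
  omega

/-- Lemma 2.4(iii): under the power-formula hypothesis, for `1 ≤ j ≤ p - 1`,
`1 ≤ i ≤ p² - 1` with `p ∤ i`, there are `n` not divisible by `p`, `1 ≤ s ≤ p - 1`
and `z ∈ Z` with `a^i b^(jp) = (a b^(sp))^n z`. -/
theorem exists_rep_a_pow_p {G : Type*} [Group G] [Fintype G] (p : ℕ) (hp : p.Prime) (r : ℕ)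
    (hr : r = 0 ∨ r = 1) (a b : G)
    (ha : a ∉ Subgroup.center G) (hb : b ∉ Subgroup.center G)
    (hap : a ^ p ^ 2 ∈ Subgroup.center G) (hbp : b ^ p ^ 2 ∈ Subgroup.center G)
    (hpow : ∀ i j k : ℕ, ∃ z ∈ Subgroup.center G,
      (a ^ i * b ^ j) ^ k
        = a ^ (k * (k - 1) / 2 * (i * j * r * p)) * a ^ (k * i) * b ^ (k * j) * z)
    (i j : ℕ) (hj1 : 1 ≤ j) (hj2 : j ≤ p - 1) (hi1 : 1 ≤ i) (hi2 : i ≤ p ^ 2 - 1)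
    (hpi : ¬ p ∣ i) :
    ∃ (n s : ℕ) (z : G), ¬ p ∣ n ∧ 1 ≤ s ∧ s ≤ p - 1 ∧ z ∈ Subgroup.center G ∧
      a ^ i * b ^ (j * p) = (a * b ^ (s * p)) ^ n * z := by
  obtain ⟨s, hs1, hs2, hs⟩ := exists_mul_mod_eq hp hpi hj1 (by have := hp.two_le; omega : j < p)
  obtain ⟨z, hz, h⟩ := hpow 1 (s * p) i
  have hb_exp : i * (s * p) = j * p + p ^ 2 * (i * s / p) := by
    have hdiv := Nat.mod_add_div (i * s) p
    rw [hs] at hdiv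
    calc i * (s * p) = i * s * p := (mul_assoc ..).symm
      _ = (j + p * (i * s / p)) * p := by rw [hdiv]
      _ = j * p + p ^ 2 * (i * s / p) := by ring
  have ha_exp : i * (i - 1) / 2 * (1 * (s * p) * r * p) = p ^ 2 * (i * (i - 1) / 2 * s * r) := by
    ring
  rw [hb_exp, ha_exp, pow_add, pow_mul a, pow_mul b (p ^ 2), mul_one, pow_one] at h
  set u := (a ^ p ^ 2) ^ (i * (i - 1) / 2 * s * r)
  set v := (b ^ p ^ 2) ^ (i * s / p)
  have hu : u ∈ Subgroup.center G := pow_mem hap _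
  have hv : v ∈ Subgroup.center G := pow_mem hbp _
  refine ⟨i, s, (u * (v * z))⁻¹, hpi, hs1, Nat.le_sub_one_of_lt hs2,
    inv_mem (mul_mem hu (mul_mem hv hz)), ?_⟩
  rw [h, eq_mul_inv_iff_mul_eq, ← mul_assoc, Subgroup.mem_center_iff.mp hu]
  simp only [mul_assoc]
end

section
/- Let G be a finite group with center Z, p a prime, r ∈ {0, 1}, and a, b ∈ G \ Z with a^{p²}, b^{p²} ∈ Z, such that for all nonnegative integers i, j, k there exists z ∈ Z with (a^i b^j)^k = a^{(k(k−1)/2)·ijrp} · a^{ki} · b^{kj} · z. Then for all i, j with 1 ≤ i, j ≤ p² − 1, p ∤ i and p ∤ j, there exist an integer n not divisible by p, an integer s with 1 ≤ s ≤ p² − 1 and p ∤ s, and z ∈ Z such that a^i b^j = (a^s b)^n z. -/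
theorem exists_mem_center_pow_eq_of_modEq {G : Type*} [Group G] {a : G} {N x y : ℕ}
    (ha : a ^ N ∈ Subgroup.center G) (hxy : x ≡ y [MOD N]) :
    ∃ z ∈ Subgroup.center G, a ^ x = a ^ y * z := by
  have key (k : ℕ) : a ^ k = a ^ (k % N) * (a ^ N) ^ (k / N) := by
    rw [← pow_mul, ← pow_add, Nat.mod_add_div]
  refine ⟨((a ^ N) ^ (y / N))⁻¹ * (a ^ N) ^ (x / N),
    mul_mem (inv_mem (pow_mem ha _)) (pow_mem ha _), ?_⟩
  rw [key x, key y, hxy]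
  group

theorem exists_mul_modEq_prime_sq {p i u : ℕ} (hp : p.Prime) (hpi : ¬ p ∣ i) (hpu : ¬ p ∣ u) :
    ∃ s, 1 ≤ s ∧ s ≤ p ^ 2 - 1 ∧ ¬ p ∣ s ∧ s * u ≡ i [MOD p ^ 2] := by
  have hu : u.Coprime (p ^ 2) := ((hp.coprime_iff_not_dvd.2 hpu).pow_left 2).symm
  obtain ⟨m, -, hm⟩ := Nat.exists_mul_mod_eq_one_of_coprime hu (Nat.one_lt_pow two_ne_zero hp.one_lt)
  have hs : i * m % p ^ 2 * u ≡ i [MOD p ^ 2] :=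
    calc i * m % p ^ 2 * u ≡ i * m * u [MOD p ^ 2] := (Nat.mod_modEq _ _).mul_right u
      _ = i * (u * m) := by ring
      _ ≡ i * 1 [MOD p ^ 2] :=
        Nat.ModEq.mul_left i (hm.trans (Nat.mod_eq_of_lt (Nat.one_lt_pow two_ne_zero hp.one_lt)).symm)
      _ = i := mul_one i
  have hps : ¬ p ∣ i * m % p ^ 2 := fun h =>
    hpi (((hs.of_dvd (dvd_pow_self p two_ne_zero)).dvd_iff dvd_rfl).1 (h.mul_right u))
  refine ⟨i * m % p ^ 2, Nat.one_le_iff_ne_zero.2 fun h => hps (h.symm ▸ dvd_zero p),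
    Nat.le_sub_one_of_lt (Nat.mod_lt _ (pow_pos hp.pos 2)), hps, hs⟩


/-- Lemma 2.4(iv): under the power-formula hypothesis, for `1 ≤ i, j ≤ p² - 1` with
`p ∤ i` and `p ∤ j`, there are `n` not divisible by `p`, `1 ≤ s ≤ p² - 1` with
`p ∤ s`, and `z ∈ Z` with `a^i b^j = (a^s b)^n z`. -/
theorem exists_rep_pow_s_b {G : Type*} [Group G] [Fintype G] (p : ℕ) (hp : p.Prime) (r : ℕ)
    (hr : r = 0 ∨ r = 1) (a b : G)
    (ha : a ∉ Subgroup.center G) (hb : b ∉ Subgroup.center G)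
    (hap : a ^ p ^ 2 ∈ Subgroup.center G) (hbp : b ^ p ^ 2 ∈ Subgroup.center G)
    (hpow : ∀ i j k : ℕ, ∃ z ∈ Subgroup.center G,
      (a ^ i * b ^ j) ^ k
        = a ^ (k * (k - 1) / 2 * (i * j * r * p)) * a ^ (k * i) * b ^ (k * j) * z)
    (i j : ℕ) (hi1 : 1 ≤ i) (hi2 : i ≤ p ^ 2 - 1) (hj1 : 1 ≤ j) (hj2 : j ≤ p ^ 2 - 1)
    (hpi : ¬ p ∣ i) (hpj : ¬ p ∣ j) :
    ∃ (n s : ℕ) (z : G), ¬ p ∣ n ∧ 1 ≤ s ∧ s ≤ p ^ 2 - 1 ∧ ¬ p ∣ s ∧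
      z ∈ Subgroup.center G ∧ a ^ i * b ^ j = (a ^ s * b) ^ n * z := by
  have hpu : ¬ p ∣ j * (j - 1) / 2 * r * p + j := fun h =>
    hpj ((Nat.dvd_add_right (dvd_mul_left p _)).1 h)
  obtain ⟨s, hs1, hs2, hps, hs⟩ := exists_mul_modEq_prime_sq hp hpi hpu
  obtain ⟨z, hz, hza⟩ := exists_mem_center_pow_eq_of_modEq hap hs.symm
  obtain ⟨w, hw, hwab⟩ := hpow s 1 j
  refine ⟨j, s, w⁻¹ * z, hpj, hs1, hs2, hps, mul_mem (inv_mem hw) hz, ?_⟩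
  rw [pow_one, ← pow_add, mul_one, mul_one] at hwab
  have he : j * (j - 1) / 2 * (s * r * p) + j * s = s * (j * (j - 1) / 2 * r * p + j) := by ring
  rw [hwab, he, hza, mul_assoc, ← Subgroup.mem_center_iff.1 hz (b ^ j)]
  group
end

section
/- Let G be a finite group with center Z, p a prime, r ∈ {0, 1}, and a, b ∈ G \ Z with a^{p²}, b^{p²} ∈ Z, such that for all nonnegative integers i, j, k there exists z ∈ Z with (a^i b^j)^k = a^{(k(k−1)/2)·ijrp} · a^{ki} · b^{kj} · z. Then a^p b^p = b^p a^p. -/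
/-- If `b` conjugates `x` to `x * w` with `w` central, then `b ^ n` conjugates `x` to
`x * w ^ n`. -/
theorem semiconjBy_pow_of_mem_center {G : Type*} [Group G] {b x w : G}
    (hw : w ∈ Subgroup.center G) (h : SemiconjBy b x (x * w)) (n : ℕ) :
    SemiconjBy (b ^ n) x (x * w ^ n) := by
  induction n with
  | zero => simp
  | succ n ih =>
    have hwn : SemiconjBy b (w ^ n) (w ^ n) :=
      Subgroup.mem_center_iff.mp (pow_mem hw n) b
    have hstep := (h.mul_right hwn).mul_left ih
    rwa [mul_assoc, ← pow_succ', ← pow_succ'] at hstep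

/-- Under the power-formula hypothesis, `a^p b^p = b^p a^p`. -/
theorem pow_p_commute {G : Type*} [Group G] [Fintype G] (p : ℕ) (hp : p.Prime) (r : ℕ)
    (hr : r = 0 ∨ r = 1) (a b : G)
    (ha : a ∉ Subgroup.center G) (hb : b ∉ Subgroup.center G)
    (hap : a ^ p ^ 2 ∈ Subgroup.center G) (hbp : b ^ p ^ 2 ∈ Subgroup.center G)
    (hpow : ∀ i j k : ℕ, ∃ z ∈ Subgroup.center G,
      (a ^ i * b ^ j) ^ k
        = a ^ (k * (k - 1) / 2 * (i * j * r * p)) * a ^ (k * i) * b ^ (k * j) * z) :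
    a ^ p * b ^ p = b ^ p * a ^ p := by
  obtain ⟨z, hz, h⟩ := hpow 1 1 2
  have hzc : ∀ g, g * z = z * g := Subgroup.mem_center_iff.mp hz
  have hconj : SemiconjBy b a (a ^ (r * p + 1) * z) := by
    norm_num at h
    apply mul_left_cancel (a := a)
    apply mul_right_cancel (b := b)
    calc a * (b * a) * b = (a * b) ^ 2 := by rw [pow_two]; group
      _ = a ^ (r * p) * a ^ 2 * b ^ 2 * z := h
      _ = a * a ^ (r * p + 1) * b * (b * z) := by
        rw [← pow_add, ← pow_succ', pow_two b]; simp only [mul_assoc, add_assoc]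
      _ = a * (a ^ (r * p + 1) * z * b) * b := by
        simp only [mul_assoc]; rw [hzc b, ← mul_assoc b, hzc b, mul_assoc]
  obtain ⟨w, hwdef⟩ : ∃ w, w = (a ^ p ^ 2) ^ r * z ^ p := ⟨_, rfl⟩
  have hw : w ∈ Subgroup.center G := hwdef ▸ mul_mem (pow_mem hap r) (pow_mem hz p)
  have hconj_p : SemiconjBy b (a ^ p) (a ^ p * w) := by
    have h := hconj.pow_right p
    rwa [Commute.mul_pow (hzc _), ← pow_mul,
      show (r * p + 1) * p = p + p ^ 2 * r by ring, pow_add, pow_mul, mul_assoc,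
      ← hwdef] at h
  have hwp : w ^ p = 1 := by
    have h := hconj_p.pow_right p
    rw [Commute.mul_pow (Subgroup.mem_center_iff.mp hw _), ← pow_mul, ← pow_two] at h
    have h' : b * a ^ p ^ 2 = a ^ p ^ 2 * b := Subgroup.mem_center_iff.mp hap b
    have := mul_right_cancel (h'.symm.trans h)
    exact left_eq_mul.mp this
  have hcomm := semiconjBy_pow_of_mem_center hw hconj_p p
  rw [hwp, mul_one] at hcomm
  exact hcomm.eq.symm
end

section
/- Let p be a prime and let G be a finite group with center Z such that G/Z ≅ Z_{p²} × Z_{p²}. Then p² divides |Z|, and for every x ∈ G \ Z the conjugacy class x^G = {g⁻¹ x g : g ∈ G} is contained in the coset xZ and has cardinality p or p². -/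
/-- If all the elements `x⁻¹ g⁻¹ x g` are central, then `g ↦ x⁻¹ g⁻¹ x g` is a homomorphism. -/
def commHom {G : Type*} [Group G]
    (h : ∀ x g : G, x⁻¹ * g⁻¹ * x * g ∈ Subgroup.center G) (x : G) : G →* G where
  toFun g := x⁻¹ * g⁻¹ * x * g
  map_one' := by simp
  map_mul' g k := by
    have hg := Subgroup.mem_center_iff.1 (h x g) (x⁻¹ * k⁻¹ * x)
    calc x⁻¹ * (g * k)⁻¹ * x * (g * k)
        = (x⁻¹ * k⁻¹ * x) * (x⁻¹ * g⁻¹ * x * g) * k := by group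
      _ = (x⁻¹ * g⁻¹ * x * g) * (x⁻¹ * k⁻¹ * x * k) := by rw [hg]; group

theorem commHom_apply {G : Type*} [Group G]
    (h : ∀ x g : G, x⁻¹ * g⁻¹ * x * g ∈ Subgroup.center G) (x g : G) :
    commHom h x g = x⁻¹ * g⁻¹ * x * g := rfl

theorem commHom_self {G : Type*} [Group G]
    (h : ∀ x g : G, x⁻¹ * g⁻¹ * x * g ∈ Subgroup.center G) (x : G) :
    commHom h x x = 1 := by
  simp [commHom_apply]

theorem commHom_swap {G : Type*} [Group G]
    (h : ∀ x g : G, x⁻¹ * g⁻¹ * x * g ∈ Subgroup.center G) (x g : G) :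
    commHom h x g = (commHom h g x)⁻¹ := by
  simp [commHom_apply, mul_assoc]

theorem commHom_eq_one_iff {G : Type*} [Group G]
    (h : ∀ x g : G, x⁻¹ * g⁻¹ * x * g ∈ Subgroup.center G) (x g : G) :
    commHom h x g = 1 ↔ g * x = x * g := by
  have e : x⁻¹ * g⁻¹ * x * g = (g * x)⁻¹ * (x * g) := by group
  rw [commHom_apply, e, inv_mul_eq_one]

theorem commHom_of_mem_center {G : Type*} [Group G]
    (h : ∀ x g : G, x⁻¹ * g⁻¹ * x * g ∈ Subgroup.center G) (x : G) {z : G}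
    (hz : z ∈ Subgroup.center G) : commHom h x z = 1 :=
  (commHom_eq_one_iff h x z).2 (Subgroup.mem_center_iff.1 hz x).symm

/-- If `G` is generated by `a`, `b` and its center, all commutators are powers of that of
`a` and `b`. -/
theorem commHom_mem_zpowers {G : Type*} [Group G]
    (h : ∀ x g : G, x⁻¹ * g⁻¹ * x * g ∈ Subgroup.center G) {a b : G}
    (hgen : ∀ H : Subgroup G, a ∈ H → b ∈ H → Subgroup.center G ≤ H → H = ⊤) (x g : G) :
    commHom h x g ∈ Subgroup.zpowers (commHom h a b) := by
  have key : ∀ y : G, commHom h y a ∈ Subgroup.zpowers (commHom h a b) →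
      commHom h y b ∈ Subgroup.zpowers (commHom h a b) →
      ∀ k, commHom h y k ∈ Subgroup.zpowers (commHom h a b) := by
    intro y ha hb k
    have ht := hgen ((Subgroup.zpowers (commHom h a b)).comap (commHom h y)) ha hb
      (fun z hz => by
        rw [Subgroup.mem_comap, commHom_of_mem_center h y hz]
        exact one_mem _)
    exact Subgroup.mem_comap.1 (ht ▸ Subgroup.mem_top k)
  have hab : commHom h a b ∈ Subgroup.zpowers (commHom h a b) := Subgroup.mem_zpowers _
  have hA := key a (by rw [commHom_self]; exact one_mem _) hab
  have hB := key b (by rw [commHom_swap h b a]; exact inv_mem hab)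
    (by rw [commHom_self]; exact one_mem _)
  refine key x ?_ ?_ g
  · rw [commHom_swap h x a]; exact inv_mem (hA x)
  · rw [commHom_swap h x b]; exact inv_mem (hB x)

theorem ncard_conjClass_eq_card_range {G : Type*} [Group G]
    (h : ∀ x g : G, x⁻¹ * g⁻¹ * x * g ∈ Subgroup.center G) (x : G) :
    {y : G | ∃ g : G, y = g⁻¹ * x * g}.ncard = Nat.card (commHom h x).range := by
  have himg : {y : G | ∃ g : G, y = g⁻¹ * x * g} =
      (fun y => x * y) '' ((commHom h x).range : Set G) := by
    ext y
    constructor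
    · rintro ⟨g, rfl⟩
      exact ⟨_, ⟨g, rfl⟩, by simp only [commHom_apply]; group⟩
    · rintro ⟨_, ⟨g, rfl⟩, rfl⟩
      exact ⟨g, by simp only [commHom_apply]; group⟩
  rw [himg, Set.ncard_image_of_injective _ (mul_right_injective x)]
  rfl

/-- Let `p` be a prime and `G` a finite group with `G/Z(G) ≅ Z_(p²) × Z_(p²)`. Then `p²`
divides `|Z|`, and for every `x ∈ G \ Z` the conjugacy class `x^G = {g⁻¹ x g : g ∈ G}`
is contained in the coset `xZ` and has cardinality `p` or `p²`. -/
theorem conjClass_subset_coset_and_card {G : Type*} [Group G] [Fintype G] (p : ℕ)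
    (hp : p.Prime)
    (hiso : Nonempty ((G ⧸ Subgroup.center G) ≃*
      (Multiplicative (ZMod (p ^ 2)) × Multiplicative (ZMod (p ^ 2))))) :
    p ^ 2 ∣ Nat.card (Subgroup.center G) ∧
    ∀ x : G, x ∉ Subgroup.center G →
      {y : G | ∃ g : G, y = g⁻¹ * x * g} ⊆ {y : G | ∃ z ∈ Subgroup.center G, y = x * z} ∧
      ({y : G | ∃ g : G, y = g⁻¹ * x * g}.ncard = p ∨
        {y : G | ∃ g : G, y = g⁻¹ * x * g}.ncard = p ^ 2) := by
  obtain ⟨e⟩ := hiso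
  have := Fact.mk hp
  let f : G →* Multiplicative (ZMod (p ^ 2)) × Multiplicative (ZMod (p ^ 2)) :=
    e.toMonoidHom.comp (QuotientGroup.mk' (Subgroup.center G))
  have hf : ∀ g, f g = 1 ↔ g ∈ Subgroup.center G := fun g => by
    change e (g : G ⧸ Subgroup.center G) = 1 ↔ _
    rw [map_eq_one_iff e e.injective, QuotientGroup.eq_one_iff]
  have hfs : Function.Surjective f :=
    e.surjective.comp (QuotientGroup.mk'_surjective _)
  have h : ∀ x g : G, x⁻¹ * g⁻¹ * x * g ∈ Subgroup.center G := fun x g => by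
    rw [← hf]
    simp only [map_mul, map_inv]
    rw [mul_comm (f x)⁻¹, mul_assoc, mul_assoc, inv_mul_cancel_left, inv_mul_cancel]
  obtain ⟨a, ha⟩ := hfs (Multiplicative.ofAdd 1, 1)
  obtain ⟨b, hb⟩ := hfs (1, Multiplicative.ofAdd 1)
  have hgen : ∀ H : Subgroup G, a ∈ H → b ∈ H → Subgroup.center G ≤ H → H = ⊤ := by
    intro H haH hbH hZ
    rw [eq_top_iff]
    intro g _
    have hpow : ∀ u : Multiplicative (ZMod (p ^ 2)),
        ∃ n : ℕ, u = (Multiplicative.ofAdd 1) ^ n := fun u =>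
      ⟨(Multiplicative.toAdd u).val, by
        rw [← ofAdd_nsmul, nsmul_one, ZMod.natCast_zmod_val, ofAdd_toAdd]⟩
    obtain ⟨i, hi⟩ := hpow (f g).1
    obtain ⟨j, hj⟩ := hpow (f g).2
    have hg : f g = f (a ^ i * b ^ j) := by
      rw [map_mul, map_pow, map_pow, ha, hb]
      ext1 <;> simp [hi, hj]
    have hz : (a ^ i * b ^ j)⁻¹ * g ∈ H :=
      hZ ((hf _).1 (by rw [map_mul, map_inv, hg, inv_mul_cancel]))
    exact (H.mul_mem_cancel_left (H.inv_mem (mul_mem (pow_mem haH i) (pow_mem hbH j)))).1 hz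
  have hbpow : ∀ n : ℕ, b ^ n ∈ Subgroup.center G ↔ p ^ 2 ∣ n := fun n => by
    rw [← hf, map_pow, hb, Prod.ext_iff, ← ZMod.natCast_eq_zero_iff]
    simp [← ofAdd_nsmul]
  have horder : orderOf (commHom h a b) = p ^ (1 + 1) := by
    refine orderOf_eq_prime_pow ?_ ?_
    · rw [← map_pow, pow_one, commHom_eq_one_iff]
      intro hcomm
      have ht := hgen (Subgroup.centralizer {b ^ p})
        (Subgroup.mem_centralizer_singleton_iff.2 hcomm.symm)
        (Subgroup.mem_centralizer_singleton_iff.2 ((Commute.refl b).pow_right p))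
        (Subgroup.center_le_centralizer _)
      have hc : b ^ p ∈ Subgroup.center G := Subgroup.mem_center_iff.2 fun g =>
        Subgroup.mem_centralizer_singleton_iff.1 (ht ▸ Subgroup.mem_top g)
      have hle := Nat.le_of_dvd hp.pos ((hbpow p).1 hc)
      nlinarith [hp.two_le]
    · rw [← map_pow]
      exact commHom_of_mem_center h a ((hbpow _).2 dvd_rfl)
  refine ⟨?_, fun x hx => ⟨?_, ?_⟩⟩
  · have hcard := Subgroup.card_dvd_of_le
      ((Subgroup.zpowers_le (H := Subgroup.center G)).2 (h a b))
    rwa [Nat.card_zpowers, ← commHom_apply h a b, horder] at hcard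
  · rintro _ ⟨g, rfl⟩
    exact ⟨_, h x g, by group⟩
  · rw [ncard_conjClass_eq_card_range h x]
    have hle : (commHom h x).range ≤ Subgroup.zpowers (commHom h a b) := by
      rintro _ ⟨g, rfl⟩
      exact commHom_mem_zpowers h hgen x g
    have hdvd := Subgroup.card_dvd_of_le hle
    rw [Nat.card_zpowers, horder] at hdvd
    obtain ⟨k, hk, hk'⟩ := (Nat.dvd_prime_pow hp).1 hdvd
    have hk0 : k ≠ 0 := by
      rintro rfl
      rw [pow_zero, Subgroup.card_eq_one] at hk'
      refine hx (Subgroup.mem_center_iff.2 fun g => (commHom_eq_one_iff h x g).1 ?_)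
      rw [← Subgroup.mem_bot, ← hk']
      exact ⟨g, rfl⟩
    rw [hk']
    interval_cases k
    · exact absurd rfl hk0
    · exact Or.inl (pow_one p)
    · exact Or.inr rfl
end

section
/- Let p be a prime and let G be a finite group with center Z such that G/Z ≅ Z_{p²} × Z_{p²}. Then the number of conjugacy classes of noncentral elements of G equals n·(p² − 1) + m·(p⁴ − p²), where n = |Z|/p and m = |Z|/p². -/
section ClassTwo

open Subgroup
open scoped commutatorElement

variable {G : Type*} [Group G]

/-- In a group whose commutators are central, `⁅a, ·⁆` is a homomorphism. -/
def commutatorHom (hG : ∀ a b : G, ⁅a, b⁆ ∈ center G) (a : G) : G →* G :=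
  MonoidHom.mk' (fun b => ⁅a, b⁆) fun b c => by
    rw [commutatorElement_mul_right_eq_mul_conj, mul_assoc ⁅a, b⁆, mem_center_iff.mp (hG a c) b,
      mul_assoc, mul_assoc, mul_inv_cancel, mul_one]

theorem commutatorElement_mul_right_of_central (hG : ∀ a b : G, ⁅a, b⁆ ∈ center G)
    (a b c : G) : ⁅a, b * c⁆ = ⁅a, b⁆ * ⁅a, c⁆ :=
  map_mul (commutatorHom hG a) b c

theorem commutatorElement_zpow_right_of_central (hG : ∀ a b : G, ⁅a, b⁆ ∈ center G)
    (a b : G) (k : ℤ) : ⁅a, b ^ k⁆ = ⁅a, b⁆ ^ k :=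
  map_zpow (commutatorHom hG a) b k

theorem commutatorElement_center_right (a : G) {z : G} (hz : z ∈ center G) : ⁅a, z⁆ = 1 :=
  commutatorElement_eq_one_iff_mul_comm.mpr (mem_center_iff.mp hz a)

theorem commutatorElement_mul_left_of_central (hG : ∀ a b : G, ⁅a, b⁆ ∈ center G)
    (a b c : G) : ⁅a * b, c⁆ = ⁅a, c⁆ * ⁅b, c⁆ := by
  rw [← commutatorElement_inv, commutatorElement_mul_right_of_central hG, mul_inv_rev,
    commutatorElement_inv, commutatorElement_inv, mem_center_iff.mp (hG a c)]

theorem commutatorElement_zpow_left_of_central (hG : ∀ a b : G, ⁅a, b⁆ ∈ center G)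
    (a b : G) (k : ℤ) : ⁅a ^ k, b⁆ = ⁅a, b⁆ ^ k := by
  rw [← commutatorElement_inv, commutatorElement_zpow_right_of_central hG, ← inv_zpow,
    commutatorElement_inv]

theorem commutatorElement_zpow_mul_zpow_mul (hG : ∀ a b : G, ⁅a, b⁆ ∈ center G)
    (x y : G) {z w : G} (hz : z ∈ center G) (hw : w ∈ center G) (i j k l : ℤ) :
    ⁅x ^ i * y ^ j * z, x ^ k * y ^ l * w⁆ = ⁅x, y⁆ ^ (i * l - j * k) := by
  have hz' (a : G) : ⁅z, a⁆ = 1 := by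
    rw [← commutatorElement_inv, commutatorElement_center_right a hz, inv_one]
  simp only [commutatorElement_mul_left_of_central hG, commutatorElement_mul_right_of_central hG,
    commutatorElement_zpow_left_of_central hG, commutatorElement_zpow_right_of_central hG,
    commutatorElement_center_right _ hw, hz', commutatorElement_self, one_zpow, mul_one, one_mul]
  rw [← commutatorElement_inv x y, inv_zpow, inv_zpow, ← zpow_mul, ← zpow_mul, ← zpow_neg,
    ← zpow_add]
  congr 1
  ring

open scoped Pointwise in
/-- If `x`, `y` generate `G` modulo its center and commutators are central, then the class of
`x ^ i * y ^ j * z` is a coset of the subgroup generated by `⁅x, y⁆ ^ gcd i j`. -/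
theorem conjugatesOf_eq_smul_zpowers (hG : ∀ a b : G, ⁅a, b⁆ ∈ center G) {x y : G}
    (hxy : ∀ g : G, ∃ i j : ℤ, ∃ z ∈ center G, g = x ^ i * y ^ j * z)
    {z : G} (hz : z ∈ center G) (i j : ℤ) :
    conjugatesOf (x ^ i * y ^ j * z) =
      (x ^ i * y ^ j * z) • (zpowers (⁅x, y⁆ ^ Int.gcd i j) : Set G) := by
  set g := x ^ i * y ^ j * z with hg
  ext b
  rw [Set.mem_smul_set_iff_inv_smul_mem, SetLike.mem_coe, mem_zpowers_iff, smul_eq_mul]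
  have hconj (h : G) : h * g * h⁻¹ = g * ⁅g, h⁆⁻¹ := by
    rw [commutatorElement_inv, mem_center_iff.mp (hG h g) g]
    simp [commutatorElement_def]
  constructor
  · intro hb
    obtain ⟨h, rfl⟩ := isConj_iff.mp hb
    obtain ⟨k, l, w, hw, rfl⟩ := hxy h
    obtain ⟨r, hr⟩ : (Int.gcd i j : ℤ) ∣ -(i * l - j * k) :=
      ((Dvd.dvd.mul_right (Int.gcd_dvd_left ..) l).sub
        (Dvd.dvd.mul_right (Int.gcd_dvd_right ..) k)).neg_right
    refine ⟨r, ?_⟩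
    rw [hconj, inv_mul_cancel_left, hg, commutatorElement_zpow_mul_zpow_mul hG x y hz hw,
      ← zpow_neg, hr, zpow_mul, zpow_natCast]
  · rintro ⟨r, hr⟩
    refine isConj_iff.mpr ⟨x ^ (r * Int.gcdB i j) * y ^ (-(r * Int.gcdA i j)) * 1, ?_⟩
    rw [hconj, hg, commutatorElement_zpow_mul_zpow_mul hG x y hz (one_mem _), ← hg,
      ← eq_inv_mul_iff_mul_eq, ← hr, ← zpow_neg, ← zpow_natCast, ← zpow_mul,
      Int.gcd_eq_gcd_ab i j]
    congr 1
    ring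

end ClassTwo

section Count

variable {G : Type*} [Group G]

/-- Counting a conjugation-invariant set all of whose classes have `k` elements. -/
theorem ncard_image_conjugatesOf_mul [Finite G] {S : Set G} {k : ℕ}
    (hS : ∀ x ∈ S, conjugatesOf x ⊆ S) (hk : ∀ x ∈ S, (conjugatesOf x).ncard = k) :
    (conjugatesOf '' S).ncard * k = S.ncard := by
  classical
  have := Fintype.ofFinite G
  have himg : conjugatesOf '' S = ↑(S.toFinset.image conjugatesOf) := by simp
  rw [himg, Set.ncard_coe_finset, Set.ncard_eq_toFinset_card', Finset.card_eq_sum_card_image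
    (conjugatesOf : G → Set G) S.toFinset, Finset.sum_const_nat]
  intro C hC
  obtain ⟨x, hx, rfl⟩ := Finset.mem_image.mp hC
  rw [Set.mem_toFinset] at hx
  rw [← hk x hx, ← Set.ncard_coe_finset]
  congr 1
  ext a
  simp only [Finset.coe_filter, Set.mem_toFinset, Set.mem_ofPred_eq,
    ← isConj_iff_conjugatesOf_eq]
  exact ⟨fun h => h.2.symm, fun h => ⟨hS x hx h, IsConj.symm h⟩⟩

end Count

section Quotient

open Subgroup
open scoped commutatorElement

variable {G : Type*} [Group G] {n : ℕ}
  {π : G →* Multiplicative (ZMod n) × Multiplicative (ZMod n)}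

theorem commutatorElement_mem_center_of_ker_eq_center (hker : π.ker = center G) (a b : G) :
    ⁅a, b⁆ ∈ center G := by
  rw [← hker, MonoidHom.mem_ker, map_commutatorElement]
  exact commutatorElement_eq_one_iff_mul_comm.mpr (mul_comm _ _)

theorem exists_eq_zpow_mul_zpow_mul [NeZero n] (hker : π.ker = center G) {x y : G}
    (hx : π x = (Multiplicative.ofAdd 1, 1)) (hy : π y = (1, Multiplicative.ofAdd 1)) (g : G) :
    ∃ z ∈ center G, g = x ^ ((π g).1.toAdd.val : ℤ) * y ^ ((π g).2.toAdd.val : ℤ) * z := by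
  refine ⟨(x ^ ((π g).1.toAdd.val : ℤ) * y ^ ((π g).2.toAdd.val : ℤ))⁻¹ * g, ?_, by group⟩
  rw [← hker, MonoidHom.mem_ker, map_mul, map_inv, inv_mul_eq_one]
  simp only [zpow_natCast, map_mul, map_pow, hx, hy]
  ext <;> simp [← ofAdd_nsmul]

theorem orderOf_commutatorElement_of_ker_eq_center [NeZero n] (hker : π.ker = center G) {x y : G}
    (hx : π x = (Multiplicative.ofAdd 1, 1)) (hy : π y = (1, Multiplicative.ofAdd 1)) :
    orderOf ⁅x, y⁆ = n := by
  have hG := commutatorElement_mem_center_of_ker_eq_center hker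
  have hxmem (k : ℕ) : x ^ k ∈ center G ↔ n ∣ k := by
    rw [← hker, MonoidHom.mem_ker, map_pow, hx, ← ZMod.natCast_eq_zero_iff]
    simp [Prod.ext_iff, ← ofAdd_nsmul]
  have hzero (k : ℕ) : ⁅x ^ k, y⁆ = ⁅x, y⁆ ^ k := by
    simpa using commutatorElement_zpow_left_of_central hG x y k
  refine Nat.dvd_antisymm (orderOf_dvd_of_pow_eq_one ?_) ((hxmem _).mp ?_)
  · rw [← hzero, ← commutatorElement_inv, commutatorElement_center_right _ ((hxmem n).mpr dvd_rfl),
      inv_one]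
  · refine mem_center_iff.mpr fun g => ?_
    obtain ⟨z, hz, hgz⟩ := exists_eq_zpow_mul_zpow_mul hker hx hy g
    refine (commutatorElement_eq_one_iff_mul_comm.mp ?_).symm
    have h := commutatorElement_zpow_mul_zpow_mul hG x y (one_mem _) hz
      (orderOf ⁅x, y⁆) 0 ((π g).1.toAdd.val) ((π g).2.toAdd.val)
    rw [← hgz, zpow_natCast, zpow_zero, mul_one, mul_one, zero_mul, sub_zero, zpow_mul,
      zpow_natCast, zpow_natCast, pow_orderOf_eq_one, one_pow] at h
    exact h

theorem ncard_conjugatesOf_of_ker_eq_center [Finite G] [NeZero n] (hker : π.ker = center G)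
    (hsurj : Function.Surjective π) (g : G) :
    (conjugatesOf g).ncard =
      n / n.gcd ((π g).1.toAdd.val.gcd (π g).2.toAdd.val) := by
  obtain ⟨x, hx⟩ := hsurj (Multiplicative.ofAdd 1, 1)
  obtain ⟨y, hy⟩ := hsurj (1, Multiplicative.ofAdd 1)
  obtain ⟨z, hz, hg⟩ := exists_eq_zpow_mul_zpow_mul hker hx hy g
  have hclass := conjugatesOf_eq_smul_zpowers (commutatorElement_mem_center_of_ker_eq_center hker)
    (fun h => ⟨_, _, exists_eq_zpow_mul_zpow_mul hker hx hy h⟩) hz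
    ((π g).1.toAdd.val) ((π g).2.toAdd.val)
  rw [← hg] at hclass
  rw [hclass, Set.ncard_smul_set, ← Nat.card_coe_set_eq, SetLike.coe_sort_coe, Nat.card_zpowers]
  rw [Int.gcd_natCast_natCast, orderOf_pow, orderOf_commutatorElement_of_ker_eq_center hker hx hy]

/-- Reduction modulo `m` of a homomorphism to `(ZMod n)²`, for `m ∣ n`. -/
def reduceHom {m : ℕ} (hmn : m ∣ n)
    (π : G →* Multiplicative (ZMod n) × Multiplicative (ZMod n)) :
    G →* Multiplicative (ZMod m) × Multiplicative (ZMod m) :=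
  let r := (ZMod.castHom hmn (ZMod m)).toAddMonoidHom.toMultiplicative
  (r.prodMap r).comp π

theorem reduceHom_surjective {m : ℕ} (hmn : m ∣ n) (hsurj : Function.Surjective π) :
    Function.Surjective (reduceHom hmn π) := by
  have hr : Function.Surjective (ZMod.castHom hmn (ZMod m)).toAddMonoidHom.toMultiplicative :=
    ZMod.castHom_surjective hmn
  exact (hr.prodMap hr).comp hsurj

theorem mem_ker_reduceHom_iff [NeZero n] {m : ℕ} (hmn : m ∣ n) (g : G) :
    g ∈ (reduceHom hmn π).ker ↔ m ∣ (π g).1.toAdd.val.gcd (π g).2.toAdd.val := by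
  have hr (a : ZMod n) : ZMod.castHom hmn (ZMod m) a = 0 ↔ m ∣ a.val := by
    rw [ZMod.castHom_apply, ← ZMod.natCast_val, ZMod.natCast_eq_zero_iff]
  rw [Nat.dvd_gcd_iff, ← hr, ← hr, MonoidHom.mem_ker, Prod.ext_iff]
  rfl

theorem mem_ker_iff_dvd_gcd_val [NeZero n] (g : G) :
    g ∈ π.ker ↔ n ∣ (π g).1.toAdd.val.gcd (π g).2.toAdd.val := by
  rw [Nat.dvd_gcd_iff, ← ZMod.natCast_eq_zero_iff, ← ZMod.natCast_eq_zero_iff, ZMod.natCast_zmod_val,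
    ZMod.natCast_zmod_val, MonoidHom.mem_ker, Prod.ext_iff]
  rfl

theorem conjugatesOf_subset_diff {H K : Subgroup G} [H.Normal] [K.Normal] {x : G}
    (hx : x ∈ (H : Set G) \ K) : conjugatesOf x ⊆ (H : Set G) \ K := by
  intro y hy
  obtain ⟨c, rfl⟩ := isConj_iff.mp hy
  refine ⟨Normal.conj_mem ‹H.Normal› _ hx.1 _, fun h => hx.2 ?_⟩
  simpa [mul_assoc] using Normal.conj_mem ‹K.Normal› _ h c⁻¹

theorem card_ker_mul_sq {m : ℕ} {φ : G →* Multiplicative (ZMod m) × Multiplicative (ZMod m)}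
    (hsurj : Function.Surjective φ) : Nat.card φ.ker * m ^ 2 = Nat.card G := by
  rw [← φ.ker.card_mul_index, index_ker, MonoidHom.range_eq_top.mpr hsurj, card_top, Nat.card_prod,
    Nat.card_congr Multiplicative.toAdd, Nat.card_zmod, sq]

theorem ncard_image_conjugatesOf_compl_center [Finite G] {p : ℕ} (hp : p.Prime)
    {π : G →* Multiplicative (ZMod (p ^ 2)) × Multiplicative (ZMod (p ^ 2))}
    (hker : π.ker = center G) (hsurj : Function.Surjective π) :
    (conjugatesOf '' (center G : Set G)ᶜ).ncard
      = (Nat.card (center G) / p) * (p ^ 2 - 1)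
        + (Nat.card (center G) / p ^ 2) * (p ^ 4 - p ^ 2) := by
  have : NeZero (p ^ 2) := ⟨pow_ne_zero 2 hp.ne_zero⟩
  have hdvd : p ∣ p ^ 2 := dvd_pow_self p two_ne_zero
  set H := (reduceHom hdvd π).ker
  have hZH : center G ≤ H := fun g hg => by
    rw [← hker, mem_ker_iff_dvd_gcd_val] at hg
    exact (mem_ker_reduceHom_iff hdvd g).mpr (hdvd.trans hg)
  have hcardH : Nat.card H * p ^ 2 = Nat.card G := card_ker_mul_sq (reduceHom_surjective hdvd hsurj)
  have hcardZ : Nat.card (center G) * (p ^ 2) ^ 2 = Nat.card G := hker ▸ card_ker_mul_sq hsurj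
  have hcardHZ : Nat.card H = Nat.card (center G) * p ^ 2 := by
    refine Nat.eq_of_mul_eq_mul_right (pow_pos hp.pos 2) ?_
    rw [hcardH, ← hcardZ]
    ring
  have hZdvd : p ^ 2 ∣ Nat.card (center G) := by
    obtain ⟨x, hx⟩ := hsurj (Multiplicative.ofAdd 1, 1)
    obtain ⟨y, hy⟩ := hsurj (1, Multiplicative.ofAdd 1)
    rw [← orderOf_commutatorElement_of_ker_eq_center hker hx hy]
    exact orderOf_dvd_natCard _ (commutatorElement_mem_center_of_ker_eq_center hker x y)
  have houter := ncard_image_conjugatesOf_mul (G := G) (S := ((⊤ : Subgroup G) : Set G) \ H)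
    (k := p ^ 2) (fun _ => conjugatesOf_subset_diff) fun x hx => by
      rw [ncard_conjugatesOf_of_ker_eq_center hker hsurj, Nat.Coprime.gcd_eq_one, Nat.div_one]
      refine Nat.Coprime.pow_left 2 ((hp.coprime_iff_not_dvd).mpr ?_)
      exact fun h => hx.2 ((mem_ker_reduceHom_iff hdvd x).mpr h)
  have hinner := ncard_image_conjugatesOf_mul (G := G) (S := (H : Set G) \ center G) (k := p)
    (fun _ => conjugatesOf_subset_diff) fun x hx => by
      have h1 := (mem_ker_reduceHom_iff hdvd x).mp hx.1
      have h2 : ¬ p ^ 2 ∣ _ := fun h => hx.2 (hker ▸ (mem_ker_iff_dvd_gcd_val x).mpr h)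
      rw [ncard_conjugatesOf_of_ker_eq_center hker hsurj]
      set d := (π x).1.toAdd.val.gcd (π x).2.toAdd.val
      have hgcd : (p ^ 2).gcd d = p := by
        obtain ⟨k, hk, hpk⟩ := (Nat.dvd_prime_pow hp).mp (Nat.gcd_dvd_left (p ^ 2) d)
        have h3 : p ∣ p ^ k := hpk ▸ Nat.dvd_gcd hdvd h1
        interval_cases k
        · exact absurd (by simpa using h3) hp.ne_one
        · simpa using hpk
        · exact absurd (Nat.gcd_eq_left_iff_dvd.mp hpk) h2
      rw [hgcd, sq, Nat.mul_div_cancel _ hp.pos]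
  have hncard (K : Subgroup G) : (K : Set G).ncard = Nat.card K :=
    (Nat.card_coe_set_eq (K : Set G)).symm
  rw [Set.ncard_sdiff (by simp), hncard, hncard, card_top] at houter
  rw [Set.ncard_sdiff hZH, hncard, hncard] at hinner
  have hunion : (center G : Set G)ᶜ =
      ((H : Set G) \ center G) ∪ (((⊤ : Subgroup G) : Set G) \ H) := by
    ext g
    have := @hZH g
    simp only [Set.mem_compl_iff, Set.mem_union, Set.mem_sdiff, SetLike.mem_coe, mem_top]
    tauto
  have hdisj : Disjoint (conjugatesOf '' ((H : Set G) \ center G))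
      (conjugatesOf '' (((⊤ : Subgroup G) : Set G) \ H)) := by
    rw [Set.disjoint_left]
    rintro _ ⟨x, hx, rfl⟩ ⟨y, hy, hxy⟩
    have : x ∈ conjugatesOf y := hxy ▸ mem_conjugatesOf_self
    exact (conjugatesOf_subset_diff hy this).2 hx.1
  rw [hunion, Set.image_union, Set.ncard_union_eq hdisj]
  obtain ⟨m, hm⟩ := hZdvd
  rw [hcardHZ, hm] at hinner
  rw [← hcardZ, hcardHZ, hm] at houter
  have hdivp : Nat.card (center G) / p = m * p := by
    rw [hm, sq, mul_assoc, Nat.mul_div_cancel_left _ hp.pos, mul_comm]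
  have hdivp2 : Nat.card (center G) / p ^ 2 = m := by
    rw [hm, Nat.mul_div_cancel_left _ (pow_pos hp.pos 2)]
  rw [hdivp, hdivp2]
  congr 1
  · refine Nat.eq_of_mul_eq_mul_right hp.pos (hinner.trans ?_)
    rw [← Nat.mul_sub_one]
    ring
  · refine Nat.eq_of_mul_eq_mul_right (pow_pos hp.pos 2) (houter.trans ?_)
    rw [← Nat.mul_sub, ← pow_mul]
    ring

end Quotient


/-- Let `p` be a prime and `G` a finite group with `G/Z(G) ≅ Z_(p²) × Z_(p²)`. Then the
number of conjugacy classes of noncentral elements of `G` equals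
`n·(p² - 1) + m·(p⁴ - p²)` where `n = |Z|/p` and `m = |Z|/p²`. -/
theorem card_noncentral_conjClasses_abelian_quotient {G : Type*} [Group G] [Fintype G]
    (p : ℕ) (hp : p.Prime)
    (hiso : Nonempty ((G ⧸ Subgroup.center G) ≃*
      (Multiplicative (ZMod (p ^ 2)) × Multiplicative (ZMod (p ^ 2))))) :
    {C : Set G | ∃ x : G, x ∉ Subgroup.center G ∧
        C = {y : G | ∃ g : G, y = g⁻¹ * x * g}}.ncard
      = (Nat.card (Subgroup.center G) / p) * (p ^ 2 - 1)
        + (Nat.card (Subgroup.center G) / p ^ 2) * (p ^ 4 - p ^ 2) := by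
  obtain ⟨e⟩ := hiso
  have hclass : {C : Set G | ∃ x : G, x ∉ Subgroup.center G ∧
      C = {y : G | ∃ g : G, y = g⁻¹ * x * g}} = conjugatesOf '' (Subgroup.center G : Set G)ᶜ := by
    have hconj (x : G) : {y : G | ∃ g : G, y = g⁻¹ * x * g} = conjugatesOf x := by
      ext y
      refine Iff.trans ⟨?_, ?_⟩ isConj_iff.symm
      · rintro ⟨g, rfl⟩
        exact ⟨g⁻¹, by simp⟩
      · rintro ⟨g, rfl⟩
        exact ⟨g⁻¹, by simp⟩
    ext C
    simp [hconj, eq_comm]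
  rw [hclass]
  refine ncard_image_conjugatesOf_compl_center hp
    (π := e.toMonoidHom.comp (QuotientGroup.mk' (Subgroup.center G))) ?_
    (e.surjective.comp (QuotientGroup.mk'_surjective _))
  ext g
  simp
end
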